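/- Let n ≥ 4 be even. There is no permutation σ of {1,…,n} whose cycle type is (n−1, 1) (i.e., σ is the product of a single (n−1)-cycle and one fixed point) such that the longest increasing subsequence of σ has length n/2 and the longest decreasing subsequence of σ has length 2. -/

import Mathlib

open Equiv

/-- `s` is (the index set of) an increasing subsequence of the permutation `σ`. -/
def IsIncSubseq {n : ℕ} (σ : Perm (Fin n)) (s : Finset (Fin n)) : Prop :=
  ∀ i ∈ s, ∀ j ∈ s, i < j → σ i < σ j

/-- `s` is (the index set of) a decreasing subsequence of the permutation `σ`. -/
def IsDecSubseq {n : ℕ} (σ : Perm (Fin n)) (s : Finset (Fin n)) : Prop :=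
  ∀ i ∈ s, ∀ j ∈ s, i < j → σ j < σ i

/-- The cycle type of `σ`, counting each fixed point as a cycle of length `1`. -/
def fullCycleType {n : ℕ} (σ : Perm (Fin n)) : Multiset ℕ :=
  σ.cycleType + Multiset.replicate (n - σ.cycleType.sum) 1

/-- A permutation without decreasing subsequences of length three has no pattern `321`. -/
theorem not_decreasing_triple {n : ℕ} {σ : Perm (Fin n)}
    (h : ∀ s, IsDecSubseq σ s → s.card ≤ 2) {i j k : Fin n} (hij : i < j) (hjk : j < k)
    (hσij : σ j < σ i) : ¬ σ k < σ j := by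
  intro hσjk
  have hcard : ({i, j, k} : Finset (Fin n)).card = 3 :=
    Finset.card_eq_three.mpr ⟨i, j, k, hij.ne, (hij.trans hjk).ne, hjk.ne, rfl⟩
  have hdec : IsDecSubseq σ {i, j, k} := by
    intro a ha b hb hab
    simp only [Finset.mem_insert, Finset.mem_singleton] at ha hb
    rcases ha with rfl | rfl | rfl <;> rcases hb with rfl | rfl | rfl <;> order
  have := h _ hdec
  omega

/-- If a permutation of a finite type maps a finset into itself, it reflects membership. -/
theorem mem_of_apply_mem_of_mapsTo {α : Type*} [DecidableEq α] {σ : Perm α} {s : Finset α}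
    (h : ∀ x ∈ s, σ x ∈ s) {x : α} (hx : σ x ∈ s) : x ∈ s := by
  have himage : s.image σ = s :=
    Finset.eq_of_subset_of_card_le (Finset.image_subset_iff.mpr h)
      (Finset.card_image_of_injective s σ.injective).ge
  rw [← himage, Finset.mem_image] at hx
  obtain ⟨y, hy, hyx⟩ := hx
  exact σ.injective hyx ▸ hy

/-- A fixed point of a `321`-avoiding permutation exceeds every earlier value. -/
theorem apply_lt_of_lt_fixed {n : ℕ} {σ : Perm (Fin n)}
    (h : ∀ s, IsDecSubseq σ s → s.card ≤ 2) {k : Fin n} (hk : σ k = k) {i : Fin n}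
    (hi : i < k) : σ i < k := by
  by_contra! hle
  have hne : σ i ≠ k := fun he => hi.ne (σ.injective (he.trans hk.symm))
  have hlt : k < σ i := lt_of_le_of_ne hle hne.symm
  have hmaps : ∀ x ∈ Finset.Ioi k, σ x ∈ Finset.Ioi k := by
    intro x hx
    rw [Finset.mem_Ioi] at hx ⊢
    have hxk : σ x ≠ k := fun he => hx.ne' (σ.injective (he.trans hk.symm))
    have := not_decreasing_triple h hi hx (hk.symm ▸ hlt)
    rw [hk] at this
    order
  have := Finset.mem_Ioi.mp (mem_of_apply_mem_of_mapsTo hmaps (Finset.mem_Ioi.mpr hlt))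
  order

/-- A fixed point of a `321`-avoiding permutation is below every later value. -/
theorem lt_apply_of_fixed_lt {n : ℕ} {σ : Perm (Fin n)}
    (h : ∀ s, IsDecSubseq σ s → s.card ≤ 2) {k : Fin n} (hk : σ k = k) {j : Fin n}
    (hj : k < j) : k < σ j := by
  by_contra! hle
  have hne : σ j ≠ k := fun he => hj.ne' (σ.injective (he.trans hk.symm))
  have hmem := mem_of_apply_mem_of_mapsTo (σ := σ) (s := Finset.Iio k)
    (fun x hx => Finset.mem_Iio.mpr (apply_lt_of_lt_fixed h hk (Finset.mem_Iio.mp hx)))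
    (Finset.mem_Iio.mpr (lt_of_le_of_ne hle hne))
  exact hj.not_gt (Finset.mem_Iio.mp hmem)

/-- A `321`-avoiding permutation of `n` points with a fixed point has two increasing subsequences
whose lengths add up to `n + 1`. -/
theorem exists_incSubseq_card_add_card {n : ℕ} {σ : Perm (Fin n)}
    (h : ∀ s, IsDecSubseq σ s → s.card ≤ 2) {k : Fin n} (hk : σ k = k) :
    ∃ s t, IsIncSubseq σ s ∧ IsIncSubseq σ t ∧ s.card + t.card = n + 1 := by
  classical
  let top : Fin n → Prop := fun i => ∃ j, i < j ∧ σ j < σ i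
  have htop : ¬ top k := by
    rintro ⟨j, hkj, hj⟩
    exact (hk ▸ hj).not_gt (lt_apply_of_fixed_lt h hk hkj)
  refine ⟨insert k (Finset.univ.filter top), Finset.univ.filter (fun i => ¬ top i), ?_, ?_, ?_⟩
  · intro i hi j hj hij
    simp only [Finset.mem_insert, Finset.mem_filter, Finset.mem_univ, true_and] at hi hj
    rcases hi with rfl | -
    · rw [hk]
      exact lt_apply_of_fixed_lt h hk hij
    rcases hj with rfl | ⟨l, hjl, hl⟩
    · rw [hk]
      exact apply_lt_of_lt_fixed h hk hij
    by_contra! hle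
    exact not_decreasing_triple h hij hjl
      (lt_of_le_of_ne hle fun he => hij.ne' (σ.injective he)) hl
  · intro i hi j _ hij
    by_contra! hle
    exact (Finset.mem_filter.mp hi).2
      ⟨j, hij, lt_of_le_of_ne hle fun he => hij.ne' (σ.injective he)⟩
  · rw [Finset.card_insert_of_notMem (by simpa using htop)]
    have := Finset.card_filter_add_card_filter_not (s := (Finset.univ : Finset (Fin n))) top
    rw [Finset.card_univ, Fintype.card_fin] at this
    omega

/-- A permutation whose full cycle type has a part equal to `1` has a fixed point. -/
theorem exists_fixed_of_one_mem_fullCycleType {n : ℕ} {σ : Perm (Fin n)}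
    (h : 1 ∈ fullCycleType σ) : ∃ k, σ k = k := by
  by_contra! hne
  have hsupp : σ.support = Finset.univ := by
    ext x
    simpa using hne x
  have hsum : σ.cycleType.sum = n := by
    rw [Perm.sum_cycleType, hsupp, Finset.card_univ, Fintype.card_fin]
  rw [fullCycleType, hsum, Nat.sub_self, Multiset.replicate_zero, add_zero] at h
  exact absurd (Perm.two_le_of_mem_cycleType h) (by norm_num)

/-- For even `n ≥ 4`, no permutation of `{1,…,n}` with cycle type `(n-1, 1)`
has longest increasing subsequence of length `n/2` and longest decreasing
subsequence of length `2`. -/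
theorem no_perm_cycleType_n_sub_one_one_shape_half_half
    (n : ℕ) (hn : 4 ≤ n) (heven : 2 ∣ n) :
    ¬ ∃ σ : Perm (Fin n),
      fullCycleType σ = {n - 1, 1} ∧
      ((∃ s, IsIncSubseq σ s ∧ s.card = n / 2) ∧
        (∀ s, IsIncSubseq σ s → s.card ≤ n / 2)) ∧
      ((∃ s, IsDecSubseq σ s ∧ s.card = 2) ∧
        (∀ s, IsDecSubseq σ s → s.card ≤ 2)) := by
  rintro ⟨σ, hcycle, ⟨-, hinc⟩, -, hdec⟩
  obtain ⟨k, hk⟩ := exists_fixed_of_one_mem_fullCycleType (σ := σ) (by simp [hcycle])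
  obtain ⟨s, t, hs, ht, hcard⟩ := exists_incSubseq_card_add_card hdec hk
  have := hinc s hs
  have := hinc t ht
  omega
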